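/- arXiv:1504.01778 — 2 statements merged into one kernel-verified Lean document; each statement's English description precedes it below -/
import Mathlib

section
/- Let m ≤ d, let X₁, …, X_m ∈ ℝ^d be linearly independent vectors, and let b ∈ S^{m−1} have all coordinates b_i ≠ 0. Let E be the affine subspace of ℝ^d spanned by the points |b_i|^{−1}·X_i, i = 1,…,m, and let dist(0,E) be the Euclidean distance from the origin to E. Then there exists a unit vector ū ∈ span{X₁,…,X_m}, orthogonal to E, such that ⟨ū, X_i⟩ = dist(0,E)·|b_i| for all i = 1,…,m; consequently Σ_{i=1}^m ⟨ū, X_i⟩² = dist(0,E)². -/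
open scoped RealInnerProductSpace

/-- Let `m ≤ d`, let `X₁, …, X_m ∈ ℝ^d` be linearly independent, and let `b ∈ S^{m-1}` have
all coordinates nonzero. Let `E` be the affine subspace spanned by the points `|bᵢ|⁻¹ • Xᵢ`.
Then there is a unit vector `u ∈ span{X₁,…,X_m}`, orthogonal to `E`, with
`⟪u, Xᵢ⟫ = dist(0,E)·|bᵢ|` for all `i`; consequently `∑ᵢ ⟪u, Xᵢ⟫² = dist(0,E)²`. -/
theorem statement7 (d m : ℕ) (hm : m ≤ d)
    (X : Fin m → EuclideanSpace ℝ (Fin d)) (hX : LinearIndependent ℝ X)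
    (b : EuclideanSpace ℝ (Fin m)) (hb : ‖b‖ = 1) (hbi : ∀ i, b i ≠ 0)
    (E : AffineSubspace ℝ (EuclideanSpace ℝ (Fin d)))
    (hE : E = affineSpan ℝ (Set.range fun i => |b i|⁻¹ • X i)) :
    ∃ u : EuclideanSpace ℝ (Fin d), ‖u‖ = 1 ∧
      u ∈ Submodule.span ℝ (Set.range X) ∧
      (∀ p ∈ E, ∀ q ∈ E, ⟪u, p - q⟫ = 0) ∧
      (∀ i, ⟪u, X i⟫ =
        Metric.infDist (0 : EuclideanSpace ℝ (Fin d)) (E : Set (EuclideanSpace ℝ (Fin d)))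
          * |b i|) ∧
      ∑ i, ⟪u, X i⟫ ^ 2 =
        Metric.infDist (0 : EuclideanSpace ℝ (Fin d)) (E : Set (EuclideanSpace ℝ (Fin d)))
          ^ 2 := by
  set y : Fin m → EuclideanSpace ℝ (Fin d) := fun i => |b i|⁻¹ • X i with hy
  have hb0 : ∀ i, |b i| ≠ 0 := fun i => abs_ne_zero.mpr (hbi i)
  have hbsum : ∑ i, |b i| ^ 2 = 1 := by
    have h := EuclideanSpace.norm_sq_eq b
    rw [hb] at h
    simpa using h.symm
  have hyE : ∀ i, y i ∈ E := fun i => hE ▸ subset_affineSpan ℝ _ (Set.mem_range_self i)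
  have hm0 : Nonempty (Fin m) := by
    by_contra h
    rw [not_nonempty_iff] at h
    simp at hbsum
  obtain ⟨i₀⟩ := hm0
  have : Nonempty E := ⟨⟨y i₀, hyE i₀⟩⟩
  have h0 : (0 : EuclideanSpace ℝ (Fin d)) ∉ E := by
    intro h
    rw [hE] at h
    obtain ⟨w, hw, h⟩ := eq_affineCombination_of_mem_affineSpan_of_fintype h
    rw [Finset.affineCombination_eq_linear_combination _ _ _ hw] at h
    simp only [hy, smul_smul] at h
    have hw0 := Fintype.linearIndependent_iff.mp hX _ h.symm
    have : ∀ i, w i = 0 := fun i => by simpa [hbi i] using hw0 i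
    simp [this] at hw
  have hspan : ∀ p ∈ E, p ∈ Submodule.span ℝ (Set.range X) := by
    intro p hp
    rw [hE] at hp
    refine Submodule.span_le.mpr ?_ (affineSpan_subset_span hp)
    rintro _ ⟨i, rfl⟩
    exact Submodule.smul_mem _ _ (Submodule.subset_span (Set.mem_range_self i))
  set p₀ : EuclideanSpace ℝ (Fin d) := ↑(EuclideanGeometry.orthogonalProjection E 0)
  have hp₀E : p₀ ∈ E := EuclideanGeometry.orthogonalProjection_mem _
  have hp₀ne : ‖p₀‖ ≠ 0 := fun h => h0 (norm_eq_zero.mp h ▸ hp₀E)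
  have hdist : Metric.infDist (0 : EuclideanSpace ℝ (Fin d))
      (E : Set (EuclideanSpace ℝ (Fin d))) = ‖p₀‖ := by
    rw [← EuclideanGeometry.dist_orthogonalProjection_eq_infDist, dist_zero_left]
  have horth : ∀ p ∈ E, ∀ q ∈ E, ⟪p₀, p - q⟫ = 0 := by
    intro p hp q hq
    have h := EuclideanGeometry.orthogonalProjection_vsub_mem_direction_orthogonal E 0
    rw [vsub_eq_sub, sub_zero] at h
    exact Submodule.inner_left_of_mem_orthogonal (AffineSubspace.vsub_mem_direction hp hq) h
  have hinner : ∀ i, ⟪‖p₀‖⁻¹ • p₀, X i⟫ = ‖p₀‖ * |b i| := by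
    intro i
    have h := horth _ (hyE i) _ hp₀E
    rw [inner_sub_right, real_inner_self_eq_norm_sq, real_inner_smul_right, sub_eq_zero,
      inv_mul_eq_iff_eq_mul₀ (hb0 i)] at h
    rw [real_inner_smul_left, h]
    field_simp
  refine ⟨‖p₀‖⁻¹ • p₀, ?_, Submodule.smul_mem _ _ (hspan _ hp₀E), ?_, ?_, ?_⟩
  · rw [norm_smul, norm_inv, norm_norm, inv_mul_cancel₀ hp₀ne]
  · intro p hp q hq
    rw [real_inner_smul_left, horth p hp q hq, mul_zero]
  · simpa only [hdist] using hinner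
  · simp only [hinner, hdist, mul_pow, ← Finset.mul_sum, hbsum, mul_one]
end

section
/- Let C > 0, let N, M ∈ ℕ, set a₀ = 0 and a_i = 2^{i−1} for i = 1,…,N+1, and for i = 1,…,N let I_M^i = {2^{j/2^M}·a_i : j = 1,…,2^M−1} (and I_M^0 = ∅). Let (s_t)_{t ∈ Q ∪ {0}} be real numbers indexed by Q = {a₁,…,a_{N+1}} ∪ I_M^1 ∪ … ∪ I_M^N together with s_0 = 0, and suppose that for every i = 0,1,…,N: s_{a_{i+1}} − s_{a_i} ≥ C·√(a_{i+1}), and s_t − s_{a_i} ≥ −(C/2)·√(a_i) for every t ∈ I_M^i. Then s_t ≥ (C/4)·√t for every t ∈ Q. -/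
theorem mul_sqrt_le_of_forall_mul_sqrt_le_sub {C : ℝ} (hC : 0 ≤ C) {N : ℕ} {a : ℕ → ℝ}
    {s : ℝ → ℝ} (ha0 : a 0 = 0) (hs0 : s 0 = 0)
    (hinc : ∀ i ≤ N, C * √(a (i + 1)) ≤ s (a (i + 1)) - s (a i)) :
    ∀ i ≤ N + 1, C * √(a i) ≤ s (a i) := by
  intro i
  induction i with
  | zero => simp [ha0, hs0]
  | succ i ih =>
    intro hi
    have h₁ := hinc i (by omega)
    have h₂ := ih (by omega)
    have h₃ : 0 ≤ C * √(a i) := by positivity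
    linarith

theorem sqrt_two_rpow_mul_le {x b : ℝ} (hx : x ≤ 1) (hb : 0 ≤ b) :
    √((2 : ℝ) ^ x * b) ≤ 2 * √b := by
  have h : (2 : ℝ) ^ x ≤ 2 := by
    simpa using Real.rpow_le_rpow_of_exponent_le one_le_two hx
  refine Real.sqrt_le_iff.2 ⟨by positivity, ?_⟩
  rw [mul_pow, Real.sq_sqrt hb]
  nlinarith

/-- A deterministic statement: let `C > 0`, `a₀ = 0`, `a_i = 2^{i-1}` for `i ≥ 1`, and for
`1 ≤ i ≤ N` let `I_M^i = {2^{j/2^M}·a_i : j = 1,…,2^M − 1}` (with `I_M^0 = ∅`). Suppose real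
numbers `s_t`, indexed by `t ∈ Q ∪ {0}` where `Q = {a₁,…,a_{N+1}} ∪ I_M^1 ∪ … ∪ I_M^N`,
satisfy `s_0 = 0`, `s_{a_{i+1}} − s_{a_i} ≥ C·√(a_{i+1})`, and `s_t − s_{a_i} ≥ −(C/2)·√(a_i)`
for all `t ∈ I_M^i`, `0 ≤ i ≤ N`. Then `s_t ≥ (C/4)·√t` for every `t ∈ Q`. -/
theorem statement17 (C : ℝ) (hC : 0 < C) (N M : ℕ)
    (a : ℕ → ℝ) (ha0 : a 0 = 0) (ha : ∀ i : ℕ, 1 ≤ i → a i = 2 ^ (i - 1))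
    (I : ℕ → Set ℝ) (hI0 : I 0 = ∅)
    (hI : ∀ i : ℕ, 1 ≤ i →
      I i = (fun j : ℕ => (2 : ℝ) ^ ((j : ℝ) / 2 ^ M) * a i) '' Set.Icc 1 (2 ^ M - 1))
    (Q : Set ℝ) (hQ : Q = (a '' Set.Icc 1 (N + 1)) ∪ ⋃ i ∈ Set.Icc 1 N, I i)
    (s : ℝ → ℝ) (hs0 : s 0 = 0)
    (hinc : ∀ i ≤ N, C * Real.sqrt (a (i + 1)) ≤ s (a (i + 1)) - s (a i))
    (hdrop : ∀ i ≤ N, ∀ t ∈ I i, -(C / 2) * Real.sqrt (a i) ≤ s t - s (a i)) :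
    ∀ t ∈ Q, C / 4 * Real.sqrt t ≤ s t := by
  have hs := mul_sqrt_le_of_forall_mul_sqrt_le_sub hC.le ha0 hs0 hinc
  intro t ht
  rw [hQ] at ht
  rcases ht with ⟨i, hi, rfl⟩ | ht
  · have h₁ := hs i hi.2
    have h₂ : 0 ≤ C * √(a i) := by positivity
    linarith
  · simp only [Set.mem_iUnion] at ht
    obtain ⟨i, hi, ht⟩ := ht
    have hd := hdrop i hi.2 t ht
    have h₁ := hs i (hi.2.trans N.le_succ)
    have hai : 0 ≤ a i := by rw [ha i hi.1]; positivity
    rw [hI i hi.1] at ht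
    obtain ⟨j, hj, rfl⟩ := ht
    have hj' : (j : ℝ) / 2 ^ M ≤ 1 := by
      rw [div_le_one (by positivity)]
      exact_mod_cast hj.2.trans (Nat.sub_le _ _)
    have h₂ := mul_le_mul_of_nonneg_left (sqrt_two_rpow_mul_le hj' hai) hC.le
    dsimp only at hd ⊢
    linarith
end
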